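/- Let M, a be reals with 0 ≤ a < M, let k, α, β be real constants with cos k ≠ 0, and define Θ = β + α( φ + tan k · ln(cscθ − cotθ) ) on U, where cscθ − cotθ = tan(θ/2) > 0 on (0,π). Let u : U → ℝ be a positive C² function depending only on (r,θ) with ∂_r u / u = (M − r − aα)/Δ and ∂_θ u / u = −cotθ. Then the 2-form F₁₀D = (u/√Δ)[ −a cos k sinθ coshΘ dt∧dr + Δ sin k sinhΘ dt∧dθ + Δ cos k sinθ sinhΘ dt∧dφ − ρ² sin k coshΘ dr∧dθ − (r²+a²) cos k sinθ coshΘ dr∧dφ + aΔ sin k sin²θ sinhΘ dθ∧dφ ] is closed and force-free on U: F₁₀D_{μν} j^ν = 0 for all μ, where j is the current density of F₁₀D. -/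

import Mathlib

noncomputable section

/-- Partial derivative of `f` in the coordinate direction `μ`,
coordinates `(x 0, x 1, x 2, x 3) = (t, r, θ, φ)`. -/
def pd (μ : Fin 4) (f : (Fin 4 → ℝ) → ℝ) (x : Fin 4 → ℝ) : ℝ :=
  fderiv ℝ f x (Pi.single μ 1)

/-- ρ² = r² + a² cos²θ. -/
def rho2 (a : ℝ) (x : Fin 4 → ℝ) : ℝ := (x 1) ^ 2 + a ^ 2 * Real.cos (x 2) ^ 2

/-- Δ = r² − 2Mr + a². -/
def Del (M a : ℝ) (x : Fin 4 → ℝ) : ℝ := (x 1) ^ 2 - 2 * M * (x 1) + a ^ 2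

/-- Σ² = (r²+a²)² − Δ a² sin²θ. -/
def Sig2 (M a : ℝ) (x : Fin 4 → ℝ) : ℝ :=
  ((x 1) ^ 2 + a ^ 2) ^ 2 - Del M a x * a ^ 2 * Real.sin (x 2) ^ 2

/-- The Kerr metric in Boyer–Lindquist coordinates `(t, r, θ, φ)`. -/
def kerr (M a : ℝ) (x : Fin 4 → ℝ) : Matrix (Fin 4) (Fin 4) ℝ :=
  Matrix.of fun μ ν =>
    if μ = 0 ∧ ν = 0 then -1 + 2 * M * (x 1) / rho2 a x
    else if (μ = 0 ∧ ν = 3) ∨ (μ = 3 ∧ ν = 0) then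
      -(2 * M * (x 1) * a * Real.sin (x 2) ^ 2) / rho2 a x
    else if μ = 1 ∧ ν = 1 then rho2 a x / Del M a x
    else if μ = 2 ∧ ν = 2 then rho2 a x
    else if μ = 3 ∧ ν = 3 then Sig2 M a x * Real.sin (x 2) ^ 2 / rho2 a x
    else 0

/-- The exterior Kerr domain U = {r > r₊, 0 < θ < π}. -/
def KerrExt (M a : ℝ) : Set (Fin 4 → ℝ) :=
  {x | M + Real.sqrt (M ^ 2 - a ^ 2) < x 1 ∧ 0 < x 2 ∧ x 2 < Real.pi}

/-- `wedge μ ν f` is the antisymmetric matrix of the 2-form `f dx^μ ∧ dx^ν`. -/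
def wedge (μ ν : Fin 4) (f : ℝ) : Matrix (Fin 4) (Fin 4) ℝ :=
  Matrix.of fun i j => if i = μ ∧ j = ν then f else if i = ν ∧ j = μ then -f else 0

/-- A 2-form `F` is closed on `S`: ∂_μ F_{νλ} + ∂_ν F_{λμ} + ∂_λ F_{μν} = 0. -/
def Closed2Form (F : (Fin 4 → ℝ) → Matrix (Fin 4) (Fin 4) ℝ) (S : Set (Fin 4 → ℝ)) : Prop :=
  ∀ x ∈ S, ∀ μ ν lam : Fin 4,
    pd μ (fun y => F y ν lam) x + pd ν (fun y => F y lam μ) x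
      + pd lam (fun y => F y μ ν) x = 0

/-- Current density j^μ = (ρ²sinθ)⁻¹ ∂_ν (ρ²sinθ g^{μα} g^{νβ} F_{αβ}). -/
def current (M a : ℝ) (F : (Fin 4 → ℝ) → Matrix (Fin 4) (Fin 4) ℝ)
    (x : Fin 4 → ℝ) (μ : Fin 4) : ℝ :=
  (rho2 a x * Real.sin (x 2))⁻¹ *
    ∑ ν : Fin 4, pd ν (fun y => rho2 a y * Real.sin (y 2) *
      ∑ i : Fin 4, ∑ j : Fin 4, (kerr M a y)⁻¹ μ i * (kerr M a y)⁻¹ ν j * F y i j) x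

/-- `F` is force-free on `S`: F_{μν} j^ν = 0 for the current density `j` of `F`. -/
def ForceFree (M a : ℝ) (F : (Fin 4 → ℝ) → Matrix (Fin 4) (Fin 4) ℝ)
    (S : Set (Fin 4 → ℝ)) : Prop :=
  ∀ x ∈ S, ∀ μ : Fin 4, ∑ ν : Fin 4, F x μ ν * current M a F x ν = 0

/-- Θ = β + α( φ + tan k · ln(cscθ − cotθ) ). -/
def ThD (k α β : ℝ) (x : Fin 4 → ℝ) : ℝ :=
  β + α * (x 3 + Real.tan k *
    Real.log ((Real.sin (x 2))⁻¹ - Real.cos (x 2) / Real.sin (x 2)))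

/-- The 2-form F₁₀D. -/
def F10D (M a k α β : ℝ) (u : ℝ × ℝ → ℝ) (x : Fin 4 → ℝ) : Matrix (Fin 4) (Fin 4) ℝ :=
  let TH := ThD k α β
  wedge 0 1 (u (x 1, x 2) / Real.sqrt (Del M a x) *
      (-(a * Real.cos k * Real.sin (x 2) * Real.cosh (TH x))))
    + wedge 0 2 (u (x 1, x 2) / Real.sqrt (Del M a x) *
      (Del M a x * Real.sin k * Real.sinh (TH x)))
    + wedge 0 3 (u (x 1, x 2) / Real.sqrt (Del M a x) *
      (Del M a x * Real.cos k * Real.sin (x 2) * Real.sinh (TH x)))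
    + wedge 1 2 (u (x 1, x 2) / Real.sqrt (Del M a x) *
      (-(rho2 a x * Real.sin k * Real.cosh (TH x))))
    + wedge 1 3 (u (x 1, x 2) / Real.sqrt (Del M a x) *
      (-(((x 1) ^ 2 + a ^ 2) * Real.cos k * Real.sin (x 2) * Real.cosh (TH x))))
    + wedge 2 3 (u (x 1, x 2) / Real.sqrt (Del M a x) *
      (a * Del M a x * Real.sin k * Real.sin (x 2) ^ 2 * Real.sinh (TH x)))

/-- `f` is differentiable at `x` with partial derivatives `c`. -/
def HP (f : (Fin 4 → ℝ) → ℝ) (x c : Fin 4 → ℝ) : Prop :=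
  DifferentiableAt ℝ f x ∧ ∀ μ, pd μ f x = c μ

theorem HP.mul {f g : (Fin 4 → ℝ) → ℝ} {x c d : Fin 4 → ℝ} (hf : HP f x c) (hg : HP g x d) :
    HP (fun y => f y * g y) x (fun μ => c μ * g x + f x * d μ) := by
  refine ⟨hf.1.mul hg.1, fun μ => ?_⟩
  have h := hf.2 μ
  have h' := hg.2 μ
  unfold pd at *
  rw [fderiv_fun_mul hf.1 hg.1]
  simp [h, h']
  ring

theorem HP.add {f g : (Fin 4 → ℝ) → ℝ} {x c d : Fin 4 → ℝ} (hf : HP f x c) (hg : HP g x d) :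
    HP (fun y => f y + g y) x (fun μ => c μ + d μ) := by
  refine ⟨hf.1.add hg.1, fun μ => ?_⟩
  have h := hf.2 μ
  have h' := hg.2 μ
  unfold pd at *
  rw [fderiv_fun_add hf.1 hg.1]
  simp [h, h']

theorem HP.neg {f : (Fin 4 → ℝ) → ℝ} {x c : Fin 4 → ℝ} (hf : HP f x c) :
    HP (fun y => - f y) x (fun μ => - c μ) := by
  refine ⟨hf.1.neg, fun μ => ?_⟩
  have h := hf.2 μ
  unfold pd at *
  rw [fderiv_fun_neg]
  simp [h]

theorem HP.const (b : ℝ) (x : Fin 4 → ℝ) : HP (fun _ => b) x (fun _ => 0) := by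
  refine ⟨differentiableAt_const _, fun μ => ?_⟩
  simp [pd]

theorem HP.coord (i : Fin 4) (x : Fin 4 → ℝ) :
    HP (fun y => y i) x (fun μ => if μ = i then 1 else 0) := by
  refine ⟨differentiableAt_apply i x, fun μ => ?_⟩
  unfold pd
  rw [(hasFDerivAt_apply i x).fderiv]
  simp [Pi.single_apply, eq_comm]

theorem HP.comp {f : (Fin 4 → ℝ) → ℝ} {x c : Fin 4 → ℝ} {h : ℝ → ℝ} {h' : ℝ}
    (hh : HasDerivAt h h' (f x)) (hf : HP f x c) :
    HP (fun y => h (f y)) x (fun μ => h' * c μ) := by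
  have H := hh.comp_hasFDerivAt x hf.1.hasFDerivAt
  refine ⟨H.differentiableAt, fun μ => ?_⟩
  have h1 := hf.2 μ
  unfold pd at *
  have h2 : fderiv ℝ (fun y => h (f y)) x = h' • fderiv ℝ f x := H.fderiv
  rw [h2]
  simp [h1]

theorem HP.congr {f g : (Fin 4 → ℝ) → ℝ} {x c d : Fin 4 → ℝ} (hf : HP f x c)
    (hfg : g =ᶠ[nhds x] f) (hcd : ∀ μ, c μ = d μ) : HP g x d := by
  refine ⟨hf.1.congr_of_eventuallyEq hfg, fun μ => ?_⟩
  rw [← hcd, ← hf.2 μ]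
  unfold pd
  rw [hfg.fderiv_eq]

theorem isOpen_KerrExt (M a : ℝ) : IsOpen (KerrExt M a) := by
  unfold KerrExt
  refine IsOpen.inter (isOpen_lt continuous_const (continuous_apply 1)) ?_
  exact IsOpen.inter (isOpen_lt continuous_const (continuous_apply 2))
    (isOpen_lt (continuous_apply 2) continuous_const)

theorem ext_facts {M a : ℝ} (ha : 0 ≤ a) (haM : a < M) {x : Fin 4 → ℝ} (hx : x ∈ KerrExt M a) :
    0 < x 1 ∧ 0 < Real.sin (x 2) ∧ 0 < Del M a x ∧ 0 < rho2 a x := by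
  obtain ⟨h1, h2, h3⟩ := hx
  have hs : 0 ≤ Real.sqrt (M ^ 2 - a ^ 2) := Real.sqrt_nonneg _
  have hs2 : Real.sqrt (M ^ 2 - a ^ 2) ^ 2 = M ^ 2 - a ^ 2 := Real.sq_sqrt (by nlinarith)
  have hr : 0 < x 1 := by linarith
  refine ⟨hr, Real.sin_pos_of_pos_of_lt_pi h2 h3, ?_, ?_⟩
  · unfold Del
    nlinarith
  · unfold rho2
    positivity

/-- Antisymmetric matrix with prescribed upper entries. -/
def asym (f01 f02 f03 f12 f13 f23 : ℝ) : Matrix (Fin 4) (Fin 4) ℝ :=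
  !![0, f01, f02, f03; -f01, 0, f12, f13; -f02, -f12, 0, f23; -f03, -f13, -f23, 0]

/-- The common factor u/√Δ. -/
def qf (M a : ℝ) (u : ℝ × ℝ → ℝ) (x : Fin 4 → ℝ) : ℝ := u (x 1, x 2) / Real.sqrt (Del M a x)

theorem F10D_eq (M a k α β : ℝ) (u : ℝ × ℝ → ℝ) (x : Fin 4 → ℝ) :
    F10D M a k α β u x = asym
      (qf M a u x * (-(a * Real.cos k * Real.sin (x 2) * Real.cosh (ThD k α β x))))
      (qf M a u x * (Del M a x * Real.sin k * Real.sinh (ThD k α β x)))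
      (qf M a u x * (Del M a x * Real.cos k * Real.sin (x 2) * Real.sinh (ThD k α β x)))
      (qf M a u x * (-(rho2 a x * Real.sin k * Real.cosh (ThD k α β x))))
      (qf M a u x * (-(((x 1) ^ 2 + a ^ 2) * Real.cos k * Real.sin (x 2)
        * Real.cosh (ThD k α β x))))
      (qf M a u x * (a * Del M a x * Real.sin k * Real.sin (x 2) ^ 2
        * Real.sinh (ThD k α β x))) := by
  ext i j
  unfold F10D qf asym
  fin_cases i <;> fin_cases j <;> simp [wedge]

/-- The explicit inverse metric. -/
def kinv (M a : ℝ) (x : Fin 4 → ℝ) : Matrix (Fin 4) (Fin 4) ℝ :=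
  !![-(Sig2 M a x / (rho2 a x * Del M a x)), 0, 0, -(2 * M * x 1 * a / (rho2 a x * Del M a x));
     0, Del M a x / rho2 a x, 0, 0;
     0, 0, 1 / rho2 a x, 0;
     -(2 * M * x 1 * a / (rho2 a x * Del M a x)), 0, 0,
       (Del M a x - a ^ 2 * Real.sin (x 2) ^ 2)
        / (rho2 a x * Del M a x * Real.sin (x 2) ^ 2)]

theorem kerr_inv {M a : ℝ} {x : Fin 4 → ℝ} (hs : Real.sin (x 2) ≠ 0) (hD : Del M a x ≠ 0)
    (hr : rho2 a x ≠ 0) : (kerr M a x)⁻¹ = kinv M a x := by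
  apply Matrix.inv_eq_right_inv
  have hc : Real.cos (x 2) ^ 2 = 1 - Real.sin (x 2) ^ 2 := by
    rw [← Real.sin_sq_add_cos_sq (x 2)]; ring
  ext i j
  fin_cases i <;> fin_cases j <;>
    simp [kerr, kinv, Matrix.mul_apply, Fin.sum_univ_four] <;> field_simp <;>
    (try simp only [Sig2, rho2, Del, hc]) <;> try ring

/-- ρ² sinθ F^{μν}, explicitly. -/
def Wf (M a k α β : ℝ) (u : ℝ × ℝ → ℝ) (x : Fin 4 → ℝ) : Matrix (Fin 4) (Fin 4) ℝ :=
  asym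
    (qf M a u x * (a * Del M a x * Real.cos k * Real.sin (x 2) ^ 2 * Real.cosh (ThD k α β x)))
    (qf M a u x * (-(((x 1) ^ 2 + a ^ 2) * Real.sin k * Real.sin (x 2)
        * Real.sinh (ThD k α β x))))
    (qf M a u x * (-(rho2 a x * Real.cos k * Real.sinh (ThD k α β x))))
    (qf M a u x * (-(Del M a x * Real.sin k * Real.sin (x 2) * Real.cosh (ThD k α β x))))
    (qf M a u x * (-(Del M a x * Real.cos k * Real.cosh (ThD k α β x))))
    (qf M a u x * (a * Real.sin k * Real.sin (x 2) * Real.sinh (ThD k α β x)))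

theorem W_eq {M a : ℝ} (k α β : ℝ) (u : ℝ × ℝ → ℝ) {x : Fin 4 → ℝ}
    (hs : Real.sin (x 2) ≠ 0) (hD : Del M a x ≠ 0)
    (hr : rho2 a x ≠ 0) (μ ν : Fin 4) :
    rho2 a x * Real.sin (x 2) *
      ∑ i : Fin 4, ∑ j : Fin 4, (kerr M a x)⁻¹ μ i * (kerr M a x)⁻¹ ν j
        * F10D M a k α β u x i j = Wf M a k α β u x μ ν := by
  have hc : Real.cos (x 2) ^ 2 = 1 - Real.sin (x 2) ^ 2 := by
    rw [← Real.sin_sq_add_cos_sq (x 2)]; ring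
  rw [kerr_inv hs hD hr, F10D_eq]
  unfold Wf
  generalize qf M a u x = q
  generalize Real.cosh (ThD k α β x) = C
  generalize Real.sinh (ThD k α β x) = S
  fin_cases μ <;> fin_cases ν <;>
    simp [kinv, asym, Fin.sum_univ_four] <;> field_simp <;>
    (try simp only [Sig2, rho2, Del, hc]) <;>
    try first | done | ring1 | (right; ring1)

theorem HP_T (k α β : ℝ) {x : Fin 4 → ℝ} (h2 : 0 < x 2) (h3 : x 2 < Real.pi) :
    HP (ThD k α β) x ![0, 0, α * Real.tan k / Real.sin (x 2), α] := by
  have hs : 0 < Real.sin (x 2) := Real.sin_pos_of_pos_of_lt_pi h2 h3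
  have hc1 : 0 < 1 - Real.cos (x 2) := by
    have : Real.cos (x 2) < Real.cos 0 :=
      Real.cos_lt_cos_of_nonneg_of_le_pi le_rfl h3.le h2
    rw [Real.cos_zero] at this
    linarith
  have hc : Real.cos (x 2) ^ 2 = 1 - Real.sin (x 2) ^ 2 := by
    rw [← Real.sin_sq_add_cos_sq (x 2)]; ring
  have hpos : (Real.sin (x 2))⁻¹ - Real.cos (x 2) / Real.sin (x 2) ≠ 0 := by
    have : (Real.sin (x 2))⁻¹ - Real.cos (x 2) / Real.sin (x 2)
      = (1 - Real.cos (x 2)) / Real.sin (x 2) := by field_simp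
    rw [this]; positivity
  have hd : HasDerivAt (fun t => Real.log ((Real.sin t)⁻¹ - Real.cos t / Real.sin t))
      (1 / Real.sin (x 2)) (x 2) := by
    have h := (((Real.hasDerivAt_sin (x 2)).inv hs.ne').sub
      ((Real.hasDerivAt_cos (x 2)).div (Real.hasDerivAt_sin (x 2)) hs.ne')).log hpos
    refine HasDerivAt.congr_deriv h ?_
    rw [div_eq_iff (by exact hpos)]
    simp
    field_simp
    nlinarith [hc]
  have H := (HP.const β x).add ((HP.const α x).mul ((HP.coord 3 x).add
    ((HP.const (Real.tan k) x).mul (HP.comp hd (HP.coord 2 x)))))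
  refine H.congr (Filter.Eventually.of_forall fun y => rfl) ?_
  intro μ
  fin_cases μ <;> simp
  ring

theorem HP_Del (M a : ℝ) (x : Fin 4 → ℝ) : HP (Del M a) x ![0, 2 * x 1 - 2 * M, 0, 0] := by
  have hd : HasDerivAt (fun r : ℝ => r ^ 2 - 2 * M * r + a ^ 2) (2 * x 1 - 2 * M) (x 1) := by
    have h := (((hasDerivAt_id (x 1)).pow 2).sub ((hasDerivAt_id (x 1)).const_mul (2 * M))).add_const
      (a ^ 2)
    refine HasDerivAt.congr_deriv h ?_
    simp
  refine (HP.comp hd (HP.coord 1 x)).congr (Filter.Eventually.of_forall fun y => rfl) ?_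
  intro μ
  fin_cases μ <;> simp

theorem HP_sin (x : Fin 4 → ℝ) :
    HP (fun y => Real.sin (y 2)) x ![0, 0, Real.cos (x 2), 0] := by
  refine (HP.comp (Real.hasDerivAt_sin (x 2)) (HP.coord 2 x)).congr
    (Filter.Eventually.of_forall fun y => rfl) ?_
  intro μ
  fin_cases μ <;> simp

theorem HP_ra (a : ℝ) (x : Fin 4 → ℝ) :
    HP (fun y => (y 1) ^ 2 + a ^ 2) x ![0, 2 * x 1, 0, 0] := by
  refine (((HP.coord 1 x).mul (HP.coord 1 x)).add (HP.const (a ^ 2) x)).congr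
    (Filter.Eventually.of_forall fun y => by simp; ring) ?_
  intro μ
  fin_cases μ <;> simp
  ring

theorem HP_rho (a : ℝ) (x : Fin 4 → ℝ) :
    HP (rho2 a) x ![0, 2 * x 1, -(2 * a ^ 2 * Real.cos (x 2) * Real.sin (x 2)), 0] := by
  have hc := HP.comp (Real.hasDerivAt_cos (x 2)) (HP.coord 2 x)
  refine (((HP.coord 1 x).mul (HP.coord 1 x)).add ((HP.const (a ^ 2) x).mul (hc.mul hc))).congr
    (Filter.Eventually.of_forall fun y => by simp [rho2]; ring) ?_
  intro μ
  fin_cases μ <;> simp <;> ring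

theorem HP_q {M a α : ℝ} {u : ℝ × ℝ → ℝ} {x : Fin 4 → ℝ} (hD : 0 < Del M a x)
    (hs : Real.sin (x 2) ≠ 0)
    (hd : DifferentiableAt ℝ u (x 1, x 2))
    (hur : fderiv ℝ u (x 1, x 2) (1, 0)
        = u (x 1, x 2) * ((M - x 1 - a * α) / Del M a x))
    (hut : fderiv ℝ u (x 1, x 2) (0, 1)
        = u (x 1, x 2) * (-(Real.cos (x 2) / Real.sin (x 2)))) :
    HP (qf M a u) x ![0, qf M a u x * ((2 * M - 2 * x 1 - a * α) / Del M a x),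
      qf M a u x * (-(Real.cos (x 2) / Real.sin (x 2))), 0] := by
  have hu : HP (fun y => u (y 1, y 2)) x
      ![0, u (x 1, x 2) * ((M - x 1 - a * α) / Del M a x),
        u (x 1, x 2) * (-(Real.cos (x 2) / Real.sin (x 2))), 0] := by
    have hp : HasFDerivAt (fun y : Fin 4 → ℝ => (y 1, y 2)) _ x :=
      (hasFDerivAt_apply (𝕜 := ℝ) (1 : Fin 4) x).prodMk (hasFDerivAt_apply (𝕜 := ℝ) (2 : Fin 4) x)
    have H := HasFDerivAt.comp (f := fun y : Fin 4 → ℝ => (y 1, y 2)) x hd.hasFDerivAt hp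
    refine ⟨H.differentiableAt, fun μ => ?_⟩
    unfold pd
    have h2 := H.fderiv
    change fderiv ℝ (fun y : Fin 4 → ℝ => u (y 1, y 2)) x = _ at h2
    rw [h2]
    fin_cases μ
    · simp
      exact map_zero _
    · simpa using hur
    · simpa using hut
    · simp
      exact map_zero _
  have hsq : 0 < Real.sqrt (Del M a x) := Real.sqrt_pos.2 hD
  have hsd : HasDerivAt (fun t => (Real.sqrt t)⁻¹)
      (-(1 / (2 * Real.sqrt (Del M a x))) / Real.sqrt (Del M a x) ^ 2) (Del M a x) :=
    (Real.hasDerivAt_sqrt hD.ne').inv hsq.ne'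
  refine (hu.mul (HP.comp hsd (HP_Del M a x))).congr
    (Filter.Eventually.of_forall fun y => by simp [qf, div_eq_mul_inv]) ?_
  intro μ
  fin_cases μ <;> simp [qf, Real.sq_sqrt hD.le] <;> field_simp
  ring

theorem HP_asym {f01 f02 f03 f12 f13 f23 : (Fin 4 → ℝ) → ℝ} {x c01 c02 c03 c12 c13 c23 : Fin 4 → ℝ}
    (h01 : HP f01 x c01) (h02 : HP f02 x c02) (h03 : HP f03 x c03)
    (h12 : HP f12 x c12) (h13 : HP f13 x c13) (h23 : HP f23 x c23) (i j : Fin 4) :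
    HP (fun y => asym (f01 y) (f02 y) (f03 y) (f12 y) (f13 y) (f23 y) i j) x
      (fun μ => asym (c01 μ) (c02 μ) (c03 μ) (c12 μ) (c13 μ) (c23 μ) i j) := by
  have h0 := HP.const 0 x
  fin_cases i <;> fin_cases j
  · exact h0
  · exact h01
  · exact h02
  · exact h03
  · exact h01.neg
  · exact h0
  · exact h12
  · exact h13
  · exact h02.neg
  · exact h12.neg
  · exact h0
  · exact h23
  · exact h03.neg
  · exact h13.neg
  · exact h23.neg
  · exact h0

set_option maxHeartbeats 4000000 in
theorem closed_at {M a k α β : ℝ} {u : ℝ × ℝ → ℝ} {x : Fin 4 → ℝ}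
    (hk : Real.cos k ≠ 0) (hs : Real.sin (x 2) ≠ 0) (hD : Del M a x ≠ 0)
    (hT : HP (ThD k α β) x ![0, 0, α * Real.tan k / Real.sin (x 2), α])
    (hq : HP (qf M a u) x ![0, qf M a u x * ((2 * M - 2 * x 1 - a * α) / Del M a x),
      qf M a u x * (-(Real.cos (x 2) / Real.sin (x 2))), 0]) (μ ν lam : Fin 4) :
    pd μ (fun y => F10D M a k α β u y ν lam) x + pd ν (fun y => F10D M a k α β u y lam μ) x
      + pd lam (fun y => F10D M a k α β u y μ ν) x = 0 := by
  have hC := HP.comp (Real.hasDerivAt_cosh _) hT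
  have hS := HP.comp (Real.hasDerivAt_sinh _) hT
  have hsn := HP_sin x
  have hDl := HP_Del M a x
  have h := HP_asym
    (hq.mul ((((HP.const a x).mul (HP.const (Real.cos k) x)).mul hsn).mul hC).neg)
    (hq.mul ((hDl.mul (HP.const (Real.sin k) x)).mul hS))
    (hq.mul (((hDl.mul (HP.const (Real.cos k) x)).mul hsn).mul hS))
    (hq.mul (((HP_rho a x).mul (HP.const (Real.sin k) x)).mul hC).neg)
    (hq.mul ((((HP_ra a x).mul (HP.const (Real.cos k) x)).mul hsn).mul hC).neg)
    (hq.mul (((((HP.const a x).mul hDl).mul (HP.const (Real.sin k) x)).mul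
      (hsn.mul hsn)).mul hS))
  simp only [F10D_eq, pow_two (Real.sin _)]
  rw [(h ν lam).2, (h lam μ).2, (h μ ν).2]
  have hk' : Real.sin k = Real.tan k * Real.cos k := (Real.tan_mul_cos hk).symm
  have hr : rho2 a x = x 1 ^ 2 + a ^ 2 - a ^ 2 * Real.sin (x 2) ^ 2 := by
    unfold rho2; rw [Real.cos_sq']; ring
  rw [hk', hr]
  generalize Real.tan k = t
  generalize qf M a u x = q
  generalize Real.cosh (ThD k α β x) = C
  generalize Real.sinh (ThD k α β x) = S
  generalize Del M a x = D at *
  generalize Real.cos k = c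
  generalize Real.sin (x 2) = s at *
  fin_cases μ <;> fin_cases ν <;> fin_cases lam <;> simp [asym] <;> field_simp <;> ring

theorem current_at {M a k α β : ℝ} {u : ℝ × ℝ → ℝ} {x : Fin 4 → ℝ}
    (hk : Real.cos k ≠ 0) (hs : Real.sin (x 2) ≠ 0) (hD : Del M a x ≠ 0)
    (hT : HP (ThD k α β) x ![0, 0, α * Real.tan k / Real.sin (x 2), α])
    (hq : HP (qf M a u) x ![0, qf M a u x * ((2 * M - 2 * x 1 - a * α) / Del M a x),
      qf M a u x * (-(Real.cos (x 2) / Real.sin (x 2))), 0]) (μ : Fin 4) :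
    ∑ ν, pd ν (fun y => Wf M a k α β u y μ ν) x =
      -(qf M a u x * α * Real.cos k * (1 + Real.tan k ^ 2)) *
        ![(x 1 ^ 2 + a ^ 2) * Real.cosh (ThD k α β x), Del M a x * Real.sinh (ThD k α β x), 0,
          a * Real.cosh (ThD k α β x)] μ := by
  have hC := HP.comp (Real.hasDerivAt_cosh _) hT
  have hS := HP.comp (Real.hasDerivAt_sinh _) hT
  have hsn := HP_sin x
  have hDl := HP_Del M a x
  have h := HP_asym
    (hq.mul (((((HP.const a x).mul hDl).mul (HP.const (Real.cos k) x)).mul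
      (hsn.mul hsn)).mul hC))
    (hq.mul ((((HP_ra a x).mul (HP.const (Real.sin k) x)).mul hsn).mul hS).neg)
    (hq.mul (((HP_rho a x).mul (HP.const (Real.cos k) x)).mul hS).neg)
    (hq.mul (((hDl.mul (HP.const (Real.sin k) x)).mul hsn).mul hC).neg)
    (hq.mul ((hDl.mul (HP.const (Real.cos k) x)).mul hC).neg)
    (hq.mul ((((HP.const a x).mul (HP.const (Real.sin k) x)).mul hsn).mul hS))
  simp only [Wf, pow_two (Real.sin _)]
  rw [Fin.sum_univ_four, (h μ 0).2, (h μ 1).2, (h μ 2).2, (h μ 3).2]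
  have hk' : Real.sin k = Real.tan k * Real.cos k := (Real.tan_mul_cos hk).symm
  have hr : rho2 a x = x 1 ^ 2 + a ^ 2 - a ^ 2 * Real.sin (x 2) ^ 2 := by
    unfold rho2; rw [Real.cos_sq']; ring
  rw [hk', hr]
  generalize Real.tan k = t
  generalize qf M a u x = q
  generalize Real.cosh (ThD k α β x) = C
  generalize Real.sinh (ThD k α β x) = S
  generalize Del M a x = D at *
  generalize Real.cos k = c
  generalize Real.sin (x 2) = s at *
  fin_cases μ <;> simp [asym] <;> field_simp <;> ring

theorem force_alg (M a k α β K : ℝ) (u : ℝ × ℝ → ℝ) (x : Fin 4 → ℝ) (μ : Fin 4) :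
    ∑ ν : Fin 4, F10D M a k α β u x μ ν * (K *
        ![(x 1 ^ 2 + a ^ 2) * Real.cosh (ThD k α β x), Del M a x * Real.sinh (ThD k α β x), 0,
          a * Real.cosh (ThD k α β x)] ν) = 0 := by
  have hr : rho2 a x = x 1 ^ 2 + a ^ 2 - a ^ 2 * Real.sin (x 2) ^ 2 := by
    unfold rho2; rw [Real.cos_sq']; ring
  rw [F10D_eq, hr, Fin.sum_univ_four]
  fin_cases μ <;> simp [asym] <;> ring

/-- F₁₀D is closed and force-free on U. -/
theorem kerr_F10D_forcefree (M a k α β : ℝ) (ha : 0 ≤ a) (haM : a < M)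
    (hk : Real.cos k ≠ 0)
    (u : ℝ × ℝ → ℝ)
    (hu : ContDiffOn ℝ 2 u
      (Set.Ioi (M + Real.sqrt (M ^ 2 - a ^ 2)) ×ˢ Set.Ioo 0 Real.pi))
    (hupos : ∀ p ∈ Set.Ioi (M + Real.sqrt (M ^ 2 - a ^ 2)) ×ˢ Set.Ioo 0 Real.pi,
      0 < u p)
    (hur : ∀ p ∈ Set.Ioi (M + Real.sqrt (M ^ 2 - a ^ 2)) ×ˢ Set.Ioo 0 Real.pi,
      fderiv ℝ u p (1, 0)
        = u p * ((M - p.1 - a * α) / (p.1 ^ 2 - 2 * M * p.1 + a ^ 2)))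
    (hut : ∀ p ∈ Set.Ioi (M + Real.sqrt (M ^ 2 - a ^ 2)) ×ˢ Set.Ioo 0 Real.pi,
      fderiv ℝ u p (0, 1) = u p * (-(Real.cos p.2 / Real.sin p.2))) :
    Closed2Form (F10D M a k α β u) (KerrExt M a) ∧
    ForceFree M a (F10D M a k α β u) (KerrExt M a) := by
  have key : ∀ x ∈ KerrExt M a, Real.sin (x 2) ≠ 0 ∧ Del M a x ≠ 0 ∧ rho2 a x ≠ 0 ∧
      HP (ThD k α β) x ![0, 0, α * Real.tan k / Real.sin (x 2), α] ∧
      HP (qf M a u) x ![0, qf M a u x * ((2 * M - 2 * x 1 - a * α) / Del M a x),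
        qf M a u x * (-(Real.cos (x 2) / Real.sin (x 2))), 0] := by
    intro x hx
    obtain ⟨_, hs, hD, hr⟩ := ext_facts ha haM hx
    obtain ⟨h1, h2, h3⟩ := hx
    have hp : (x 1, x 2) ∈ Set.Ioi (M + Real.sqrt (M ^ 2 - a ^ 2)) ×ˢ Set.Ioo 0 Real.pi :=
      ⟨h1, h2, h3⟩
    have hd : DifferentiableAt ℝ u (x 1, x 2) :=
      (hu.differentiableOn (by norm_num)).differentiableAt
        ((isOpen_Ioi.prod isOpen_Ioo).mem_nhds hp)
    exact ⟨hs.ne', hD.ne', hr.ne', HP_T k α β h2 h3,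
      HP_q hD hs.ne' hd (hur _ hp) (hut _ hp)⟩
  constructor
  · intro x hx μ ν lam
    obtain ⟨hs, hD, hr, hT, hq⟩ := key x hx
    exact closed_at hk hs hD hT hq μ ν lam
  · intro x hx μ
    obtain ⟨hs, hD, hr, hT, hq⟩ := key x hx
    have hcur : ∀ ν, current M a (F10D M a k α β u) x ν =
        ((rho2 a x * Real.sin (x 2))⁻¹ * -(qf M a u x * α * Real.cos k * (1 + Real.tan k ^ 2))) *
        ![(x 1 ^ 2 + a ^ 2) * Real.cosh (ThD k α β x), Del M a x * Real.sinh (ThD k α β x), 0,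
          a * Real.cosh (ThD k α β x)] ν := by
      intro ν
      unfold current
      rw [mul_assoc, ← current_at hk hs hD hT hq ν]
      congr 1
      refine Finset.sum_congr rfl fun l _ => ?_
      unfold pd
      rw [Filter.EventuallyEq.fderiv_eq]
      filter_upwards [(isOpen_KerrExt M a).mem_nhds hx] with y hy
      obtain ⟨hs, hD, hr, -, -⟩ := key y hy
      exact W_eq k α β u hs hD hr ν l
    simp only [hcur]
    exact force_alg M a k α β _ u x μ
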